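/- Let D = {(z₁,z₂,z₃) ∈ ℂ³ : z₃ ≠ 0} and define 𝒯 : D → Matrix₂ₓ₂(ℂ) by 𝒯(z₁,z₂,z₃) = (1/z₃) · [[1, z₁ + iz₂], [z₁ − iz₂, z₁² + z₂² + z₃²]]. Then: (i) det(𝒯(z)) = 1 for every z ∈ D, so 𝒯 takes values in SL₂(ℂ); (ii) 𝒯 is injective on D; (iii) the range of 𝒯 equals {A ∈ Matrix₂ₓ₂(ℂ) : det A = 1 and A₁₁ ≠ 0}, where A₁₁ denotes the upper-left entry; and (iv) each entry of 𝒯 is a holomorphic function of (z₁,z₂,z₃) on D, and the inverse map is given by the holomorphic formulas z₃ = 1/A₁₁, z₁ = (A₁₂ + A₂₁)/(2A₁₁), z₂ = (A₁₂ − A₂₁)/(2iA₁₁) on {A ∈ SL₂(ℂ) : A₁₁ ≠ 0}. In particular, 𝒯 is a biholomorphic map of ℂ³∖{z₃ = 0} onto SL₂(ℂ)∖{A₁₁ = 0}. -/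

import Mathlib

open Set

noncomputable section

attribute [local instance] Matrix.normedAddCommGroup Matrix.normedSpace

/-- `ℂ³` with its Euclidean (Hermitian) metric. -/
abbrev C3 : Type := EuclideanSpace ℂ (Fin 3)

/-- The space of `2 × 2` complex matrices, `≅ ℂ⁴`. -/
abbrev M2C : Type := Matrix (Fin 2) (Fin 2) ℂ

/-- The transformation `𝒯(z₁,z₂,z₃) = z₃⁻¹ · [[1, z₁+iz₂], [z₁−iz₂, z₁²+z₂²+z₃²]]`. -/
def TMap (z : C3) : M2C :=
  (z 2)⁻¹ • !![1, z 0 + Complex.I * z 1;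
               z 0 - Complex.I * z 1, z 0 ^ 2 + z 1 ^ 2 + z 2 ^ 2]

/-- The inverse transformation `z₃ = 1/A₁₁`, `z₁ = (A₁₂+A₂₁)/(2A₁₁)`, `z₂ = (A₁₂−A₂₁)/(2iA₁₁)`. -/
def SMap (A : M2C) : C3 :=
  (WithLp.equiv 2 (Fin 3 → ℂ)).symm
    ![(A 0 1 + A 1 0) / (2 * A 0 0),
      (A 0 1 - A 1 0) / (2 * Complex.I * A 0 0),
      1 / A 0 0]

theorem det_TMap {z : C3} (hz : z 2 ≠ 0) : (TMap z).det = 1 := by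
  simp only [TMap, Matrix.det_fin_two, Matrix.smul_apply, Matrix.of_apply, Matrix.cons_val',
    Matrix.cons_val_zero, Matrix.cons_val_one, Matrix.cons_val_fin_one, smul_eq_mul]
  field_simp
  linear_combination z 1 ^ 2 * Complex.I_sq

theorem TMap_apply_zero_zero (z : C3) : TMap z 0 0 = (z 2)⁻¹ := by
  simp [TMap]

theorem SMap_TMap {z : C3} (hz : z 2 ≠ 0) : SMap (TMap z) = z := by
  have hI := Complex.I_ne_zero
  ext i
  fin_cases i <;> simp [SMap, TMap] <;> field_simp <;> ring

theorem TMap_SMap {A : M2C} (hdet : A.det = 1) (hA : A 0 0 ≠ 0) : TMap (SMap A) = A := by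
  have hI := Complex.I_ne_zero
  rw [Matrix.det_fin_two] at hdet
  ext i j
  fin_cases i <;> fin_cases j <;> simp [SMap, TMap]
  · field_simp
    ring
  · field_simp
    ring
  · field_simp
    simp only [Complex.I_sq]
    linear_combination 4 * hdet

theorem differentiableOn_TMap_apply (i j : Fin 2) :
    DifferentiableOn ℂ (fun z => TMap z i j) {z : C3 | z 2 ≠ 0} := by
  intro z hz
  have hz' : z 2 ≠ 0 := hz
  apply DifferentiableAt.differentiableWithinAt
  fin_cases i <;> fin_cases j <;> simp [TMap] <;> fun_prop (disch := assumption)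

theorem differentiable_matrix_apply (i j : Fin 2) : Differentiable ℂ fun A : M2C => A i j :=
  (LinearMap.toContinuousLinearMap (Matrix.entryLinearMap ℂ ℂ i j)).differentiable

theorem differentiableOn_SMap : DifferentiableOn ℂ SMap {A : M2C | A 0 0 ≠ 0} := by
  intro A hA
  have hA' : A 0 0 ≠ 0 := hA
  have h := differentiable_matrix_apply
  apply DifferentiableAt.differentiableWithinAt
  refine differentiableAt_euclidean.2 ?_
  intro i
  fin_cases i
  · change DifferentiableAt ℂ (fun B : M2C => (B 0 1 + B 1 0) / (2 * B 0 0)) A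
    simp only [div_eq_mul_inv]
    exact ((h 0 1 A).fun_add (h 1 0 A)).fun_mul
      (((h 0 0 A).const_mul 2).fun_inv (by simpa using hA'))
  · change DifferentiableAt ℂ (fun B : M2C => (B 0 1 - B 1 0) / (2 * Complex.I * B 0 0)) A
    simp only [div_eq_mul_inv]
    exact ((h 0 1 A).fun_sub (h 1 0 A)).fun_mul
      (((h 0 0 A).const_mul (2 * Complex.I)).fun_inv (by simpa using hA'))
  · change DifferentiableAt ℂ (fun B : M2C => 1 / B 0 0) A
    simp only [one_div]
    exact (h 0 0 A).fun_inv hA'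

/-- **Martín–Umehara–Yamada**: `𝒯` is a biholomorphic map of `ℂ³ ∖ {z₃ = 0}` onto
`SL₂(ℂ) ∖ {A₁₁ = 0}`, with holomorphic inverse `SMap`. -/
theorem TMap_biholomorphic :
    (∀ z : C3, z 2 ≠ 0 → (TMap z).det = 1) ∧
    InjOn TMap {z : C3 | z 2 ≠ 0} ∧
    TMap '' {z : C3 | z 2 ≠ 0} = {A : M2C | A.det = 1 ∧ A 0 0 ≠ 0} ∧
    (∀ i j : Fin 2, DifferentiableOn ℂ (fun z => TMap z i j) {z : C3 | z 2 ≠ 0}) ∧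
    (∀ z : C3, z 2 ≠ 0 → SMap (TMap z) = z) ∧
    (∀ A : M2C, A.det = 1 → A 0 0 ≠ 0 → TMap (SMap A) = A) ∧
    DifferentiableOn ℂ SMap {A : M2C | A 0 0 ≠ 0} := by
  refine ⟨fun z hz => det_TMap hz, ?_, ?_, differentiableOn_TMap_apply,
    fun z hz => SMap_TMap hz, fun A hdet hA => TMap_SMap hdet hA, differentiableOn_SMap⟩
  · exact Set.LeftInvOn.injOn (f₁' := SMap) fun z hz => SMap_TMap hz
  · ext A
    constructor
    · rintro ⟨z, hz, rfl⟩
      exact ⟨det_TMap hz, by rw [TMap_apply_zero_zero]; exact inv_ne_zero hz⟩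
    · rintro ⟨hdet, hA⟩
      exact ⟨SMap A, by simpa [SMap] using hA, TMap_SMap hdet hA⟩
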